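/- Let Ω ⊆ ℝⁿ be open, n ≥ 2, and let u : Ω → ℝ be a smooth function with |Du(x)| < 1 for all x ∈ Ω. If div(Du/√(1+|Du|²)) = 0 and div(Du/√(1−|Du|²)) = 0 on Ω, then the Hessian of u annihilates the gradient direction: D²u(x)(Du(x), Du(x)) = 0 for every x ∈ Ω. Geometrically, the Lorentzian normal curvature of the graph along the lift of the gradient direction vanishes. -/

import Mathlib

open scoped RealInnerProductSpace

/-- Divergence of a vector field on ℝⁿ. -/
noncomputable def vdiv {n : ℕ} (X : EuclideanSpace ℝ (Fin n) → EuclideanSpace ℝ (Fin n))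
    (x : EuclideanSpace ℝ (Fin n)) : ℝ :=
  ∑ i, ⟪fderiv ℝ X x (EuclideanSpace.single i 1), EuclideanSpace.single i 1⟫

/-- Hessian bilinear form `D²u(x)(v,w)` of a function on ℝⁿ. -/
noncomputable def hess {n : ℕ} (u : EuclideanSpace ℝ (Fin n) → ℝ)
    (x v w : EuclideanSpace ℝ (Fin n)) : ℝ :=
  ⟪fderiv ℝ (gradient u) x v, w⟫

/-- The Lorentz–Minkowski inner product on ℝⁿ × ℝ = 𝕃^{n+1}. -/
noncomputable def linner {n : ℕ} (p q : EuclideanSpace ℝ (Fin n) × ℝ) : ℝ :=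
  ⟪p.1, q.1⟫ - p.2 * q.2

/-- A `C²` function on an open set has a differentiable gradient there. -/
theorem differentiableAt_gradient {n : ℕ} {Ω : Set (EuclideanSpace ℝ (Fin n))} (hΩ : IsOpen Ω)
    {u : EuclideanSpace ℝ (Fin n) → ℝ} (hu : ContDiffOn ℝ 2 u Ω)
    {x : EuclideanSpace ℝ (Fin n)} (hx : x ∈ Ω) : DifferentiableAt ℝ (gradient u) x := by
  have h : DifferentiableAt ℝ (fderiv ℝ u) x :=
    ((hu.contDiffAt (hΩ.mem_nhds hx)).fderiv_right (m := 1) (by norm_num)).differentiableAt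
      (by norm_num)
  exact (InnerProductSpace.toDual ℝ
    (EuclideanSpace ℝ (Fin n))).symm.toContinuousLinearEquiv.differentiableAt.comp x h

/-- Leibniz rule for the divergence of a scalar multiple of a vector field. -/
theorem vdiv_smul {n : ℕ} {f : EuclideanSpace ℝ (Fin n) → ℝ}
    {X : EuclideanSpace ℝ (Fin n) → EuclideanSpace ℝ (Fin n)} {x : EuclideanSpace ℝ (Fin n)}
    (hf : DifferentiableAt ℝ f x) (hX : DifferentiableAt ℝ X x) :
    vdiv (fun y => f y • X y) x = f x * vdiv X x + fderiv ℝ f x (X x) := by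
  have hsum : X x = ∑ i, X x i • EuclideanSpace.single i (1 : ℝ) := by
    simpa using ((EuclideanSpace.basisFun (Fin n) ℝ).sum_repr (X x)).symm
  have hfX : fderiv ℝ f x (X x) = ∑ i, X x i * fderiv ℝ f x (EuclideanSpace.single i 1) := by
    conv_lhs => rw [hsum]
    simp
  rw [hfX]
  unfold vdiv
  rw [fderiv_fun_smul hf hX, Finset.mul_sum, ← Finset.sum_add_distrib]
  refine Finset.sum_congr rfl fun i _ => ?_
  simp [inner_add_left, EuclideanSpace.inner_single_right]
  ring

/-- The divergence of `(1 + ε |X|²)^(-1/2) X` vanishes only if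
`(1 + ε |X|²) div X = ε ⟪DX(X), X⟫`. -/
theorem mul_vdiv_eq_of_vdiv_normalized_eq_zero {n : ℕ} {ε : ℝ}
    {X : EuclideanSpace ℝ (Fin n) → EuclideanSpace ℝ (Fin n)} {x : EuclideanSpace ℝ (Fin n)}
    (hX : DifferentiableAt ℝ X x) (hpos : 0 < 1 + ε * ‖X x‖ ^ 2)
    (h : vdiv (fun y => (Real.sqrt (1 + ε * ‖X y‖ ^ 2))⁻¹ • X y) x = 0) :
    (1 + ε * ‖X x‖ ^ 2) * vdiv X x = ε * ⟪fderiv ℝ X x (X x), X x⟫ := by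
  have hs : 0 < Real.sqrt (1 + ε * ‖X x‖ ^ 2) := Real.sqrt_pos.mpr hpos
  have hf := (hasDerivAt_inv hs.ne').comp_hasFDerivAt x
    (((hX.hasFDerivAt.norm_sq.const_mul ε).const_add 1).sqrt hpos.ne')
  replace h := (vdiv_smul hf.differentiableAt hX).symm.trans h
  rw [hf.fderiv] at h
  have hsq := Real.sq_sqrt hpos.le
  simp only [Function.comp_apply, smul_apply, ContinuousLinearMap.comp_apply, smul_eq_mul,
    innerSL_apply_apply, real_inner_comm (fderiv ℝ X x (X x))] at h
  rw [← hsq]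
  generalize Real.sqrt (1 + ε * ‖X x‖ ^ 2) = s at *
  simp only [nsmul_eq_mul, Nat.cast_ofNat] at h
  field_simp at h
  linarith

/-- For a simultaneously minimal and maximal spacelike graph, the Hessian
annihilates the gradient direction. -/
theorem hessian_annihilates_gradient {n : ℕ} (hn : 2 ≤ n)
    (Ω : Set (EuclideanSpace ℝ (Fin n))) (hΩ : IsOpen Ω)
    (u : EuclideanSpace ℝ (Fin n) → ℝ) (hu : ContDiffOn ℝ (⊤ : ℕ∞) u Ω)
    (hsp : ∀ x ∈ Ω, ‖gradient u x‖ < 1)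
    (hmin : ∀ x ∈ Ω,
      vdiv (fun y => (Real.sqrt (1 + ‖gradient u y‖ ^ 2))⁻¹ • gradient u y) x = 0)
    (hmax : ∀ x ∈ Ω,
      vdiv (fun y => (Real.sqrt (1 - ‖gradient u y‖ ^ 2))⁻¹ • gradient u y) x = 0) :
    ∀ x ∈ Ω, hess u x (gradient u x) (gradient u x) = 0 := by
  intro x hx
  have hd : DifferentiableAt ℝ (gradient u) x :=
    differentiableAt_gradient hΩ (hu.of_le (by norm_cast)) hx
  have hlt : ‖gradient u x‖ ^ 2 < 1 := pow_lt_one₀ (norm_nonneg _) (hsp x hx) two_ne_zero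
  have h₁ := mul_vdiv_eq_of_vdiv_normalized_eq_zero (ε := 1) hd (by positivity)
    (by simpa using hmin x hx)
  have h₂ := mul_vdiv_eq_of_vdiv_normalized_eq_zero (ε := -1) hd (by linarith)
    (by simpa [← sub_eq_add_neg] using hmax x hx)
  have hdiv : vdiv (gradient u) x = 0 := by linarith
  rw [hdiv] at h₁
  unfold hess
  linarith
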